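/- arXiv:1811.08114 — 7 statements merged into one kernel-verified Lean document; each statement's English description precedes it below -/
import Mathlib

section
/- Let n ≥ 1 and let γ, X : ℝ → ℝ^(2+n) be differentiable curves. Fix t ∈ ℝ and assume that γ'(t) and X(t) are linearly independent. Then the following are equivalent: (i) for every u ∈ ℝ there exists λ ∈ ℝ such that (γ'(t) + u·X'(t)) ∧ X(t) = λ · (γ'(t) ∧ X(t)) in the exterior algebra of ℝ^(2+n); (ii) γ'(t) ∧ X'(t) ∧ X(t) = 0, i.e., the three vectors γ'(t), X'(t), X(t) are linearly dependent. -/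
theorem LinearIndependent.exteriorAlgebra_ιMulti_ne_zero {K E : Type*} [Field K]
    [AddCommGroup E] [Module K E] {n : ℕ} {v : Fin n → E} (hv : LinearIndependent K v) :
    ExteriorAlgebra.ιMulti K n v ≠ 0 := by
  have h := (exteriorPower.ιMulti_family_linearIndependent_field (n := n) hv).ne_zero
    (Set.powersetCard.ofFinEmbEquiv (RelEmbedding.refl (· ≤ ·)))
  rw [exteriorPower.ιMulti_family, Equiv.symm_apply_apply] at h
  exact fun h0 => h (Subtype.ext h0)


/-- **Yano's developability condition for ruled surfaces (pointwise form).**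
For differentiable curves `γ, X : ℝ → ℝ^(2+n)` with `γ'(t)` and `X(t)` linearly
independent, the 2-vector `(γ'(t) + u • X'(t)) ∧ X(t)` is a scalar multiple of
`γ'(t) ∧ X(t)` for every `u` iff `γ'(t) ∧ X'(t) ∧ X(t) = 0`. -/
theorem ruled_surface_tangent_constant_iff_wedge_zero
    (n : ℕ) (hn : 1 ≤ n)
    (γ X : ℝ → EuclideanSpace ℝ (Fin (2 + n)))
    (hγ : Differentiable ℝ γ) (hX : Differentiable ℝ X)
    (t : ℝ)
    (hind : LinearIndependent ℝ ![deriv γ t, X t]) :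
    (∀ u : ℝ, ∃ lam : ℝ,
        ExteriorAlgebra.ι ℝ (deriv γ t + u • deriv X t) * ExteriorAlgebra.ι ℝ (X t)
          = lam • (ExteriorAlgebra.ι ℝ (deriv γ t) * ExteriorAlgebra.ι ℝ (X t))) ↔
      ExteriorAlgebra.ι ℝ (deriv γ t) * ExteriorAlgebra.ι ℝ (deriv X t)
          * ExteriorAlgebra.ι ℝ (X t) = 0 := by
  have sq (v : EuclideanSpace ℝ (Fin (2 + n))) := ExteriorAlgebra.ι_sq_zero (R := ℝ) v
  constructor
  · intro h
    obtain ⟨lam, hlam⟩ := h 1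
    rw [one_smul, map_add, add_mul, ← eq_sub_iff_add_eq'] at hlam
    rw [mul_assoc, hlam, mul_sub, mul_smul_comm, ← mul_assoc, sq, zero_mul, smul_zero, sub_zero]
  · intro h u
    have hmem : deriv X t ∈ Submodule.span ℝ {deriv γ t, X t} := by
      by_contra hmem
      rw [← Matrix.range_cons_cons_empty _ _ ![]] at hmem
      refine (linearIndependent_finCons.2 ⟨hind, hmem⟩).exteriorAlgebra_ιMulti_ne_zero ?_
      have hswap := ExteriorAlgebra.ι_add_mul_swap (R := ℝ) (deriv X t) (deriv γ t)
      simp [ExteriorAlgebra.ιMulti_apply, ← mul_assoc, eq_neg_of_add_eq_zero_left hswap, h]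
    obtain ⟨c, d, hcd⟩ := Submodule.mem_span_pair.1 hmem
    refine ⟨1 + u * c, ?_⟩
    simp only [← hcd, map_add, map_smul, add_mul, smul_mul_assoc, smul_add, sq, smul_zero,
      add_zero, add_smul, one_smul, mul_smul]
end

section
/- Let m ≥ 2, n ≥ 1, and let a ≤ b be real numbers. Let γ : ℝ → ℝ^(m+n) be a smooth (C^∞) map that is injective on [a,b], and let X_1, …, X_{m−1} : ℝ → ℝ^(m+n) be smooth maps such that for every t ∈ [a,b] the m vectors γ'(t), X_1(t), …, X_{m−1}(t) are linearly independent. Then there exists ε > 0 such that the map σ : (t, u¹, …, u^{m−1}) ↦ γ(t) + u¹·X_1(t) + ⋯ + u^{m−1}·X_{m−1}(t), restricted to [a,b] × (−ε,ε)^{m−1}, is a smooth embedding: it is injective, its differential at every point of [a,b] × (−ε,ε)^{m−1} is injective, and it is a homeomorphism onto its image. -/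
/-- A map that is strictly differentiable at `x` with injective derivative is injective near `x`. -/
theorem HasStrictFDerivAt.exists_nhds_injOn {E F : Type*}
    [NormedAddCommGroup E] [NormedSpace ℝ E] [FiniteDimensional ℝ E]
    [NormedAddCommGroup F] [NormedSpace ℝ F] [FiniteDimensional ℝ F]
    {f : E → F} {f' : E →L[ℝ] F} {x : E}
    (hf : HasStrictFDerivAt f f' x) (hf' : Function.Injective f') :
    ∃ U ∈ nhds x, Set.InjOn f U := by
  have : CompleteSpace E := FiniteDimensional.complete ℝ E
  obtain ⟨g, hg⟩ := (f' : E →ₗ[ℝ] F).exists_leftInverse_of_injective (LinearMap.ker_eq_bot.2 hf')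
  let G : F →L[ℝ] E := g.toContinuousLinearMap
  have hG : HasStrictFDerivAt (G ∘ f) 
      ((ContinuousLinearEquiv.refl ℝ E : E ≃L[ℝ] E) : E →L[ℝ] E) x := by
    have hGf : G.comp f' = (ContinuousLinearEquiv.refl ℝ E : E ≃L[ℝ] E) :=
      ContinuousLinearMap.ext fun v ↦ LinearMap.congr_fun hg v
    exact hGf ▸ G.hasStrictFDerivAt.comp x hf
  refine ⟨_, (hG.toOpenPartialHomeomorph (G ∘ f)).open_source.mem_nhds
    hG.mem_toOpenPartialHomeomorph_source, fun y hy z hz hyz ↦ ?_⟩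
  exact (hG.toOpenPartialHomeomorph (G ∘ f)).injOn hy hz (congrArg G hyz)

/-- A `C¹` map that is injective and immersive on a compact set is injective and immersive on a
neighbourhood of it. -/
theorem ContDiff.exists_isOpen_injOn_immersive {E F : Type*}
    [NormedAddCommGroup E] [NormedSpace ℝ E] [FiniteDimensional ℝ E]
    [NormedAddCommGroup F] [NormedSpace ℝ F] [FiniteDimensional ℝ F]
    {f : E → F} (hf : ContDiff ℝ 1 f) {K : Set E} (hK : IsCompact K) (hinj : Set.InjOn f K)
    (himm : ∀ x ∈ K, Function.Injective (fderiv ℝ f x)) :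
    ∃ U, IsOpen U ∧ K ⊆ U ∧ Set.InjOn f U ∧ ∀ x ∈ U, Function.Injective (fderiv ℝ f x) := by
  obtain ⟨U, hUo, hKU, hU⟩ := hinj.exists_isOpen_superset hK
    (fun x _ ↦ hf.continuous.continuousAt)
    (fun x hx ↦ (hf.contDiffAt.hasStrictFDerivAt one_ne_zero).exists_nhds_injOn (himm x hx))
  have hV : IsOpen {x | Function.Injective (fderiv ℝ f x)} :=
    ContinuousLinearMap.isOpen_injective.preimage (hf.continuous_fderiv one_ne_zero)
  exact ⟨U ∩ _, hUo.inter hV, Set.subset_inter hKU himm, hU.mono Set.inter_subset_left,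
    fun x hx ↦ hx.2⟩

/-- A continuous map injective on a compact set restricts to an embedding of each subset. -/
theorem Set.InjOn.isEmbedding_restrict_of_isCompact {Y Z : Type*} [TopologicalSpace Y]
    [TopologicalSpace Z] [T2Space Z] {f : Y → Z} {K s : Set Y} (hinj : Set.InjOn f K)
    (hf : Continuous f) (hK : IsCompact K) (hs : s ⊆ K) :
    Topology.IsEmbedding (s.domRestrict f) := by
  have : CompactSpace K := isCompact_iff_compactSpace.1 hK
  have h : Topology.IsClosedEmbedding (K.domRestrict f) :=
    (hf.comp continuous_subtype_val).isClosedEmbedding hinj.injective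
  exact h.isEmbedding.comp (Topology.IsEmbedding.inclusion hs)

/-- The differential of a ruled parametrization along its base curve. -/
theorem hasFDerivAt_ruled_parametrization {F ι : Type*} [Fintype ι]
    [NormedAddCommGroup F] [NormedSpace ℝ F] {γ : ℝ → F} {X : ι → ℝ → F} {t : ℝ}
    (hγ : DifferentiableAt ℝ γ t) (hX : ∀ j, DifferentiableAt ℝ (X j) t) :
    HasFDerivAt (fun p : ℝ × (ι → ℝ) ↦ γ p.1 + ∑ j, p.2 j • X j p.1)
      ((ContinuousLinearMap.fst ℝ ℝ (ι → ℝ)).smulRight (deriv γ t) +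
        ∑ j, ((ContinuousLinearMap.proj j).comp (ContinuousLinearMap.snd ℝ ℝ (ι → ℝ))).smulRight
          (X j t)) (t, 0) := by
  have hfst : HasFDerivAt Prod.fst (ContinuousLinearMap.fst ℝ ℝ (ι → ℝ)) (t, 0) := hasFDerivAt_fst
  refine HasFDerivAt.add ?_ (HasFDerivAt.fun_sum fun j _ ↦ ?_)
  · exact (HasFDerivAt.comp (t, (0 : ι → ℝ)) hγ.hasDerivAt.hasFDerivAt hfst).congr_fderiv
      (ContinuousLinearMap.ext fun _ ↦ by simp)
  · have hc : HasFDerivAt (fun p : ℝ × (ι → ℝ) ↦ p.2 j)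
        ((ContinuousLinearMap.proj j).comp (ContinuousLinearMap.snd ℝ ℝ (ι → ℝ))) (t, 0) :=
      ((ContinuousLinearMap.proj j).comp (ContinuousLinearMap.snd ℝ ℝ (ι → ℝ))).hasFDerivAt
    exact (hc.smul (HasFDerivAt.comp (t, (0 : ι → ℝ)) (hX j).hasFDerivAt hfst)).congr_fderiv
      (ContinuousLinearMap.ext fun _ ↦ by simp)


/-- **Embedding lemma for ruled parametrizations over a compact interval.**
If `γ : ℝ → ℝ^(m+n)` is smooth and injective on `[a,b]`, and `X₁, …, X_{m-1}` are
smooth vector fields such that `γ'(t), X₁(t), …, X_{m-1}(t)` are linearly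
independent for every `t ∈ [a,b]`, then for some `ε > 0` the ruled map
`σ(t,u) = γ(t) + Σ_j u^j • X_j(t)`, restricted to `[a,b] × (-ε,ε)^{m-1}`, is a
smooth embedding: it is injective, immersive, and a topological embedding. -/
theorem ruled_parametrization_embedding
    (m n : ℕ) (hm : 2 ≤ m) (hn : 1 ≤ n) (a b : ℝ) (hab : a ≤ b)
    (γ : ℝ → EuclideanSpace ℝ (Fin (m + n)))
    (X : Fin (m - 1) → ℝ → EuclideanSpace ℝ (Fin (m + n)))
    (hγ : ContDiff ℝ (⊤ : ℕ∞) γ) (hX : ∀ j, ContDiff ℝ (⊤ : ℕ∞) (X j))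
    (hinj : Set.InjOn γ (Set.Icc a b))
    (hind : ∀ t ∈ Set.Icc a b,
      LinearIndependent ℝ (Matrix.vecCons (deriv γ t) (fun j => X j t)))
    (σ : ℝ × (Fin (m - 1) → ℝ) → EuclideanSpace ℝ (Fin (m + n)))
    (hσ : ∀ p : ℝ × (Fin (m - 1) → ℝ), σ p = γ p.1 + ∑ j, p.2 j • X j p.1) :
    ∃ ε > (0 : ℝ),
      Set.InjOn σ (Set.Icc a b ×ˢ {u : Fin (m - 1) → ℝ | ∀ j, |u j| < ε}) ∧
      (∀ p ∈ Set.Icc a b ×ˢ {u : Fin (m - 1) → ℝ | ∀ j, |u j| < ε},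
        Function.Injective (fderiv ℝ σ p)) ∧
      Topology.IsEmbedding
        ((Set.Icc a b ×ˢ {u : Fin (m - 1) → ℝ | ∀ j, |u j| < ε}).restrict σ) := by
  have hσ' : σ = fun p ↦ γ p.1 + ∑ j, p.2 j • X j p.1 := funext hσ
  have hsmooth : ContDiff ℝ 1 σ := by
    have hγ1 : ContDiff ℝ 1 γ := hγ.of_le (by exact_mod_cast le_top)
    have hX1 : ∀ j, ContDiff ℝ 1 (X j) := fun j ↦ (hX j).of_le (by exact_mod_cast le_top)
    rw [hσ']
    fun_prop
  have hbase : IsCompact (Set.Icc a b ×ˢ {(0 : Fin (m - 1) → ℝ)}) :=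
    isCompact_Icc.prod isCompact_singleton
  have hbase_inj : Set.InjOn σ (Set.Icc a b ×ˢ {(0 : Fin (m - 1) → ℝ)}) := by
    rintro ⟨s, u⟩ ⟨hs, hu⟩ ⟨t, v⟩ ⟨ht, hv⟩ h
    obtain rfl : u = 0 := hu
    obtain rfl : v = 0 := hv
    have hst : γ s = γ t := by simpa [hσ] using h
    exact Prod.ext (hinj hs ht hst) rfl
  have hbase_imm : ∀ p ∈ Set.Icc a b ×ˢ {(0 : Fin (m - 1) → ℝ)},
      Function.Injective (fderiv ℝ σ p) := by
    rintro ⟨t, u⟩ ⟨ht, hu⟩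
    obtain rfl : u = 0 := hu
    rw [hσ', (hasFDerivAt_ruled_parametrization (hγ.differentiable (by simp) t)
      (fun j ↦ (hX j).differentiable (by simp) t)).fderiv]
    refine (injective_iff_map_eq_zero _).2 ?_
    rintro ⟨s, v⟩ hsv
    have hzero := Fintype.linearIndependent_iff.1 (hind t ht) (Matrix.vecCons s v)
      (by simpa [Fin.sum_univ_succ] using hsv)
    exact Prod.ext (hzero 0) (funext fun j ↦ hzero j.succ)
  obtain ⟨U, hUo, hKU, hUinj, hUimm⟩ :=
    hsmooth.exists_isOpen_injOn_immersive hbase hbase_inj hbase_imm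
  obtain ⟨V, W, -, hW, hV, h0W, hVW⟩ :=
    generalized_tube_lemma isCompact_Icc isCompact_singleton hUo hKU
  obtain ⟨ε, hε, hεW⟩ := Metric.nhds_basis_closedBall.mem_iff.1
    (hW.mem_nhds (Set.singleton_subset_iff.1 h0W))
  have htube : Set.Icc a b ×ˢ Metric.closedBall (0 : Fin (m - 1) → ℝ) ε ⊆ U :=
    (Set.prod_mono hV hεW).trans hVW
  have hsub : Set.Icc a b ×ˢ {u : Fin (m - 1) → ℝ | ∀ j, |u j| < ε} ⊆
      Set.Icc a b ×ˢ Metric.closedBall (0 : Fin (m - 1) → ℝ) ε := by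
    refine Set.prod_mono_right fun u hu ↦ ?_
    rw [mem_closedBall_zero_iff, pi_norm_le_iff_of_nonneg hε.le]
    exact fun j ↦ (hu j).le
  exact ⟨ε, hε, hUinj.mono (hsub.trans htube), fun p hp ↦ hUimm p (htube (hsub hp)),
    (hUinj.mono htube).isEmbedding_restrict_of_isCompact hsmooth.continuous
      (isCompact_Icc.prod (isCompact_closedBall _ _)) hsub⟩
end

section
/- Let m ≥ 2, n ≥ 1, and fix vectors v, w_1, …, w_{m−1}, x_1, …, x_{m−1} ∈ ℝ^(m+n) such that the m vectors v, x_1, …, x_{m−1} are linearly independent. Then the following are equivalent: (i) for every (u¹, …, u^{m−1}) ∈ ℝ^{m−1} there exists λ ∈ ℝ such that (v + u¹·w_1 + ⋯ + u^{m−1}·w_{m−1}) ∧ x_1 ∧ ⋯ ∧ x_{m−1} = λ · (v ∧ x_1 ∧ ⋯ ∧ x_{m−1}) in the exterior algebra of ℝ^(m+n); (ii) for every j ∈ {1, …, m−1}, w_j ∧ v ∧ x_1 ∧ ⋯ ∧ x_{m−1} = 0. -/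
/-- The wedge product `v₁ ∧ ⋯ ∧ vₗ` of a list of vectors, as the product of
their images in the exterior algebra. -/
noncomputable def wedgeList {V : Type*} [AddCommGroup V] [Module ℝ V]
    (l : List V) : ExteriorAlgebra ℝ V :=
  (l.map (ExteriorAlgebra.ι ℝ)).prod

theorem wedgeList_cons {V : Type*} [AddCommGroup V] [Module ℝ V] (a : V) (l : List V) :
    wedgeList (a :: l) = ExteriorAlgebra.ι ℝ a * wedgeList l := by
  simp [wedgeList]

theorem contractLeft_wedgeList_eq_zero {V : Type*} [AddCommGroup V] [Module ℝ V]
    (d : Module.Dual ℝ V) (l : List V) (hd : ∀ a ∈ l, d a = 0) :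
    CliffordAlgebra.contractLeft (Q := (0 : QuadraticForm ℝ V)) d (wedgeList l) = 0 := by
  induction l with
  | nil => exact CliffordAlgebra.contractLeft_one (Q := (0 : QuadraticForm ℝ V)) d
  | cons a l ih =>
    rw [List.forall_mem_cons] at hd
    rw [wedgeList_cons]
    refine (CliffordAlgebra.contractLeft_ι_mul d a (wedgeList l)).trans ?_
    rw [hd.1, ih hd.2, zero_smul, mul_zero, sub_zero]

theorem wedgeList_cons_eq_smul {V : Type*} [AddCommGroup V] [Module ℝ V]
    (d : Module.Dual ℝ V) {a v : V} {l : List V} (hv : d v = 1) (hl : ∀ b ∈ l, d b = 0)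
    (h : wedgeList (a :: v :: l) = 0) :
    wedgeList (a :: l) = d a • wedgeList (v :: l) := by
  have hvl : CliffordAlgebra.contractLeft (Q := (0 : QuadraticForm ℝ V)) d (wedgeList (v :: l))
      = wedgeList l := by
    rw [wedgeList_cons]
    refine (CliffordAlgebra.contractLeft_ι_mul d v (wedgeList l)).trans ?_
    rw [hv, contractLeft_wedgeList_eq_zero d l hl, one_smul, mul_zero, sub_zero]
  have hc := CliffordAlgebra.contractLeft_ι_mul (Q := (0 : QuadraticForm ℝ V)) d a
    (wedgeList (v :: l))
  rw [hvl] at hc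
  have hz : CliffordAlgebra.ι (0 : QuadraticForm ℝ V) a * wedgeList (v :: l) = 0 :=
    (wedgeList_cons a (v :: l)).symm.trans h
  rw [hz, map_zero] at hc
  rw [wedgeList_cons a l]
  exact (sub_eq_zero.mp hc.symm).symm

theorem wedgeList_cons_cons_eq_zero {V : Type*} [AddCommGroup V] [Module ℝ V]
    {a v : V} {l : List V} {c : ℝ}
    (h : wedgeList ((v + a) :: l) = c • wedgeList (v :: l)) :
    wedgeList (a :: v :: l) = 0 := by
  simp only [wedgeList_cons, map_add, add_mul] at h ⊢
  have hvv (b : ExteriorAlgebra ℝ V) :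
      ExteriorAlgebra.ι ℝ v * (ExteriorAlgebra.ι ℝ v * b) = 0 := by
    rw [← mul_assoc, ExteriorAlgebra.ι_sq_zero, zero_mul]
  have hva : ExteriorAlgebra.ι ℝ v * (ExteriorAlgebra.ι ℝ a * wedgeList l) = 0 := by
    simpa [mul_add, hvv] using congrArg (ExteriorAlgebra.ι ℝ v * ·) h
  rw [← mul_assoc, eq_neg_of_add_eq_zero_left (ExteriorAlgebra.ι_add_mul_swap a v), neg_mul,
    mul_assoc, hva, neg_zero]

/-- **Pointwise full developability criterion for ruled submanifolds.**
Given vectors `v, x₁, …, x_{m-1}` in `ℝ^(m+n)` that are linearly independent and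
vectors `w₁, …, w_{m-1}`, the `m`-vector
`(v + u¹ • w₁ + ⋯ + u^{m-1} • w_{m-1}) ∧ x₁ ∧ ⋯ ∧ x_{m-1}` is a scalar multiple of
`v ∧ x₁ ∧ ⋯ ∧ x_{m-1}` for every `(u¹, …, u^{m-1})` iff
`w_j ∧ v ∧ x₁ ∧ ⋯ ∧ x_{m-1} = 0` for every `j`. -/
theorem ruled_tangent_constant_all_rulings_iff_wedge_zero
    (m n : ℕ) (hm : 2 ≤ m) (hn : 1 ≤ n)
    (v : EuclideanSpace ℝ (Fin (m + n)))
    (w x : Fin (m - 1) → EuclideanSpace ℝ (Fin (m + n)))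
    (hind : LinearIndependent ℝ (Matrix.vecCons v x)) :
    (∀ u : Fin (m - 1) → ℝ, ∃ lam : ℝ,
        wedgeList ((v + ∑ j, u j • w j) :: List.ofFn x)
          = lam • wedgeList (v :: List.ofFn x)) ↔
      ∀ j, wedgeList (w j :: v :: List.ofFn x) = 0 := by
  constructor
  · intro h j
    obtain ⟨c, hc⟩ := h (Pi.single j 1)
    refine wedgeList_cons_cons_eq_zero (c := c) ?_
    simpa [Pi.single_apply, ite_smul] using hc
  · intro h u
    have hv : v ∉ Submodule.span ℝ (Set.range x) := (linearIndependent_finCons.mp hind).2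
    obtain ⟨f, hfv, hf⟩ := Submodule.exists_le_ker_of_notMem hv
    have hd : ∀ b ∈ List.ofFn x, ((f v)⁻¹ • f) b = 0 := by
      intro b hb
      obtain ⟨i, rfl⟩ := List.mem_ofFn.mp hb
      have : f (x i) = 0 := hf (Submodule.subset_span ⟨i, rfl⟩)
      simp [this]
    have hdv : ((f v)⁻¹ • f) v = 1 := by simp [hfv]
    have hw j := wedgeList_cons_eq_smul _ hdv hd (h j)
    refine ⟨1 + ∑ j, u j * ((f v)⁻¹ • f) (w j), ?_⟩
    simp only [wedgeList_cons] at hw ⊢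
    simp only [map_add, map_sum, map_smul, add_mul, Finset.sum_mul, smul_mul_assoc, hw, add_smul,
      one_smul, Finset.sum_smul, mul_smul]
end

section
/- Let m ≥ 2, n ≥ 1. Let V be an m-dimensional linear subspace of ℝ^(m+n), let W = V^⊥ be its orthogonal complement, let e ∈ V be a nonzero vector, and let ρ : W → ℝ^(m+n) be a linear map whose range is contained in V. Assume there exists w ∈ W with ⟨e, ρ(w)⟩ ≠ 0. Then the following are equivalent: (i) there exists a linear subspace Σ of V with dim Σ = m − 1, e ∉ Σ, and ⟨x, ρ(w)⟩ = 0 for every x ∈ Σ and every w ∈ W; (ii) the rank of ρ is equal to 1. Moreover, when these hold, the subspace Σ is unique and equals V ∩ (range ρ)^⊥. -/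
open RealInnerProductSpace

/-- **Linear-algebra core of the geometric Cauchy problem for developable
submanifolds.** Let `V ⊆ ℝ^(m+n)` be an `m`-dimensional subspace, `W = Vᗮ`,
`e ∈ V` nonzero, and `ρ : W →ₗ ℝ^(m+n)` a linear map with range contained in `V`
such that `⟨e, ρ w⟩ ≠ 0` for some `w`. Then there is an `(m-1)`-dimensional
subspace `S ⊆ V` with `e ∉ S` and `S ⟂ range ρ` iff `ρ` has rank one; moreover
any such `S` equals `V ⊓ (range ρ)ᗮ`. -/
theorem cauchy_problem_ruling_space_exists_iff_rank_one
    (m n : ℕ) (hm : 2 ≤ m) (hn : 1 ≤ n)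
    (V : Submodule ℝ (EuclideanSpace ℝ (Fin (m + n))))
    (hV : Module.finrank ℝ V = m)
    (e : EuclideanSpace ℝ (Fin (m + n))) (heV : e ∈ V) (he0 : e ≠ 0)
    (ρ : Vᗮ →ₗ[ℝ] EuclideanSpace ℝ (Fin (m + n)))
    (hρ : LinearMap.range ρ ≤ V)
    (hcurv : ∃ w : Vᗮ, ⟪e, ρ w⟫ ≠ 0) :
    ((∃ S : Submodule ℝ (EuclideanSpace ℝ (Fin (m + n))),
        S ≤ V ∧ Module.finrank ℝ S = m - 1 ∧ e ∉ S ∧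
          ∀ x ∈ S, ∀ w : Vᗮ, ⟪x, ρ w⟫ = 0) ↔
      Module.finrank ℝ (LinearMap.range ρ) = 1) ∧
    ∀ S : Submodule ℝ (EuclideanSpace ℝ (Fin (m + n))),
      S ≤ V → Module.finrank ℝ S = m - 1 → e ∉ S →
      (∀ x ∈ S, ∀ w : Vᗮ, ⟪x, ρ w⟫ = 0) →
      S = V ⊓ (LinearMap.range ρ)ᗮ := by
  obtain ⟨w₀, hw₀⟩ := hcurv
  have hdim := Submodule.finrank_add_inf_finrank_orthogonal hρ
  rw [inf_comm] at hdim
  have heT : e ∉ V ⊓ (LinearMap.range ρ)ᗮ := fun h =>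
    hw₀ (Submodule.inner_left_of_mem_orthogonal (LinearMap.mem_range_self ρ w₀) h.2)
  have hlt : Module.finrank ℝ (V ⊓ (LinearMap.range ρ)ᗮ : Submodule ℝ _) <
      Module.finrank ℝ V :=
    Submodule.finrank_lt_finrank_of_lt
      (lt_of_le_of_ne inf_le_left fun h => heT (h.symm ▸ heV))
  have hle : ∀ S : Submodule ℝ (EuclideanSpace ℝ (Fin (m + n))), S ≤ V →
      (∀ x ∈ S, ∀ w : Vᗮ, ⟪x, ρ w⟫ = 0) → S ≤ V ⊓ (LinearMap.range ρ)ᗮ := by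
    refine fun S hSV hS x hx => ⟨hSV hx, (Submodule.mem_orthogonal' _ _).2 ?_⟩
    rintro _ ⟨w, rfl⟩
    exact hS x hx w
  refine ⟨⟨?_, fun hrank => ?_⟩, fun S hSV hSm _ hS => ?_⟩
  · rintro ⟨S, hSV, hSm, -, hS⟩
    have := Submodule.finrank_mono (hle S hSV hS)
    omega
  · refine ⟨V ⊓ (LinearMap.range ρ)ᗮ, inf_le_left, by omega, heT, fun x hx w => ?_⟩
    exact Submodule.inner_left_of_mem_orthogonal (LinearMap.mem_range_self ρ w) hx.2
  · exact Submodule.eq_of_le_of_finrank_le (hle S hSV hS) (by omega)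
end

section
/- Let m ≥ 2, n ≥ 1, let b_1, …, b_{m+n} denote the standard basis of ℝ^(m+n), and let f_1, …, f_{m−1}, g_1, …, g_n : ℝ → ℝ be smooth functions. Then there exist unique differentiable maps E_1, …, E_m, N_1, …, N_n : ℝ → ℝ^(m+n) satisfying, for all t ∈ ℝ, the linear system E_1'(t) = −Σ_{j=1}^{m−1} f_j(t)·E_{j+1}(t) − Σ_{k=1}^{n} g_k(t)·N_k(t), E_{j+1}'(t) = f_j(t)·E_1(t) for j = 1, …, m−1, and N_k'(t) = g_k(t)·E_1(t) for k = 1, …, n, with initial conditions E_i(0) = b_i for i = 1, …, m and N_k(0) = b_{m+k} for k = 1, …, n. Moreover, for every t ∈ ℝ the m+n vectors E_1(t), …, E_m(t), N_1(t), …, N_n(t) form an orthonormal basis of ℝ^(m+n). -/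
open RealInnerProductSpace

open Set Metric NNReal

section SkewODE

variable {H : Type*} [NormedAddCommGroup H] [InnerProductSpace ℝ H]

/-- Along two solutions of `x' = A(t) x` with `A(t)` skew-adjoint, the inner product is constant. -/
lemma inner_eq_of_hasDerivAt_skew {A : ℝ → H →L[ℝ] H}
    (hA : ∀ t x y, ⟪A t x, y⟫ + ⟪x, A t y⟫ = 0) {s : Set ℝ} (hs : IsOpen s)
    (hs' : IsPreconnected s) {x y : ℝ → H} (hx : ∀ t ∈ s, HasDerivAt x (A t (x t)) t)
    (hy : ∀ t ∈ s, HasDerivAt y (A t (y t)) t) {t₀ t : ℝ} (ht₀ : t₀ ∈ s) (ht : t ∈ s) :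
    ⟪x t, y t⟫ = ⟪x t₀, y t₀⟫ := by
  have h : ∀ r ∈ s, HasDerivAt (fun u => ⟪x u, y u⟫) 0 r := fun r hr => by
    have := (hx r hr).inner ℝ (hy r hr)
    rwa [add_comm, hA] at this
  exact hs.is_const_of_deriv_eq_zero hs'
    (fun r hr => (h r hr).differentiableAt.differentiableWithinAt) (fun r hr => (h r hr).deriv) ht ht₀

/-- Two solutions of `x' = A(t) x` with `A(t)` skew-adjoint agree if they agree at one point. -/
lemma eqOn_of_hasDerivAt_skew {A : ℝ → H →L[ℝ] H}
    (hA : ∀ t x y, ⟪A t x, y⟫ + ⟪x, A t y⟫ = 0) {s : Set ℝ} (hs : IsOpen s)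
    (hs' : IsPreconnected s) {x y : ℝ → H} (hx : ∀ t ∈ s, HasDerivAt x (A t (x t)) t)
    (hy : ∀ t ∈ s, HasDerivAt y (A t (y t)) t) {t₀ : ℝ} (ht₀ : t₀ ∈ s) (h₀ : x t₀ = y t₀) :
    EqOn x y s := fun t ht => by
  have hd : ∀ r ∈ s, HasDerivAt (x - y) (A r ((x - y) r)) r := fun r hr => by
    simpa using (hx r hr).sub (hy r hr)
  have := inner_eq_of_hasDerivAt_skew hA hs hs' hd hd ht₀ ht
  rw [Pi.sub_apply x y t₀, h₀, sub_self, inner_zero_left, inner_self_eq_zero] at this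
  exact sub_eq_zero.1 this

variable [FiniteDimensional ℝ H]

/-- A compactly supported cut-off of the identity is Lipschitz and bounded. -/
lemma exists_lipschitz_bounded_cutoff {R : ℝ} (hR : 0 < R) :
    ∃ (ρ : H → ℝ) (K C : ℝ≥0), LipschitzWith K (fun x => ρ x • x) ∧ (∀ x, ‖ρ x • x‖ ≤ C) ∧
      ∀ x, ‖x‖ ≤ R → ρ x = 1 := by
  let b : ContDiffBump (0 : H) := ⟨R, R + 1, hR, by linarith⟩
  have hc : HasCompactSupport fun x => b x • x := b.hasCompactSupport.smul_right
  have hd : ContDiff ℝ 1 fun x => b x • x := b.contDiff.smul contDiff_id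
  obtain ⟨K, hK⟩ := hd.lipschitzWith_of_hasCompactSupport hc one_ne_zero
  obtain ⟨C, hC⟩ := hc.exists_bound_of_continuous hd.continuous
  exact ⟨b, K, C.toNNReal, hK, fun x => (hC x).trans (Real.le_coe_toNNReal C),
    fun x hx => b.one_of_mem_closedBall (mem_closedBall_zero_iff.2 hx)⟩

/-- Solutions of `x' = A(t) x` with `A(t)` skew-adjoint exist on every symmetric interval. -/
lemma exists_hasDerivAt_skew_Ioo {A : ℝ → H →L[ℝ] H} (hAc : Continuous A)
    (hA : ∀ t x y, ⟪A t x, y⟫ + ⟪x, A t y⟫ = 0) (x₀ : H) {T : ℝ} (hT : 0 < T) :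
    ∃ x : ℝ → H, x 0 = x₀ ∧ ∀ t ∈ Ioo (-T) T, HasDerivAt x (A t (x t)) t := by
  obtain ⟨ρ, K, C, hK, hC, hρ⟩ :=
    exists_lipschitz_bounded_cutoff (H := H) (R := ‖x₀‖ + 1) (by positivity)
  obtain ⟨M', hM'⟩ := (isCompact_Icc (a := -T) (b := T)).exists_bound_of_continuousOn
    hAc.continuousOn
  obtain ⟨M, hM⟩ : ∃ M : ℝ≥0, ∀ t ∈ Icc (-T) T, ‖A t‖ ≤ M :=
    ⟨M'.toNNReal, fun t ht => (hM' t ht).trans (Real.le_coe_toNNReal M')⟩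
  let t₀ : Icc (-T) T := ⟨0, by constructor <;> linarith⟩
  have hPL : IsPicardLindelof (fun t x => A t (ρ x • x)) t₀ x₀ (M * C * T.toNNReal) 0
      (M * C) (M * K) :=
    { lipschitzOnWith := fun t ht =>
        (((A t).lipschitz.weaken (hM t ht)).comp hK).lipschitzOnWith
      continuousOn := fun x _ => (hAc.clm_apply continuous_const).continuousOn
      norm_le := fun t ht x _ => (A t).le_of_opNorm_le_of_le (hM t ht) (hC x)
      mul_max_le := by simp [t₀, hT.le] }
  obtain ⟨x, hx₀, hx⟩ := hPL.exists_eq_forall_mem_Icc_hasDerivWithinAt₀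
  have h0 : (0 : ℝ) ∈ Ioo (-T) T := by constructor <;> linarith
  have hx' : ∀ t ∈ Ioo (-T) T, HasDerivAt x ((ρ (x t) • A t) (x t)) t := fun t ht => by
    simpa using (hx t (Ioo_subset_Icc_self ht)).hasDerivAt (Icc_mem_nhds ht.1 ht.2)
  refine ⟨x, hx₀, fun t ht => ?_⟩
  have hn := inner_eq_of_hasDerivAt_skew (A := fun t => ρ (x t) • A t)
    (fun t u v => by simp [inner_smul_left, inner_smul_right, ← mul_add, hA])
    isOpen_Ioo isPreconnected_Ioo hx' hx' h0 ht
  rw [real_inner_self_eq_norm_sq, real_inner_self_eq_norm_sq,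
    sq_eq_sq₀ (norm_nonneg _) (norm_nonneg _), show x 0 = x₀ from hx₀] at hn
  simpa [hρ (x t) (by linarith)] using hx' t ht

/-- Solutions of `x' = A(t) x` with `A(t)` skew-adjoint exist for all time. -/
lemma exists_hasDerivAt_skew {A : ℝ → H →L[ℝ] H} (hAc : Continuous A)
    (hA : ∀ t x y, ⟪A t x, y⟫ + ⟪x, A t y⟫ = 0) (x₀ : H) :
    ∃ x : ℝ → H, x 0 = x₀ ∧ ∀ t, HasDerivAt x (A t (x t)) t := by
  choose y hy₀ hy using fun T : {T : ℝ // 0 < T} => exists_hasDerivAt_skew_Ioo hAc hA x₀ T.2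
  have hpos : ∀ t : ℝ, 0 < |t| + 1 := fun t => by positivity
  have heq : ∀ T : {T : ℝ // 0 < T}, ∀ t ∈ Ioo (-T.1) T.1, y ⟨|t| + 1, hpos t⟩ t = y T t := by
    intro T t ht
    have hT := T.2
    have hm : 0 < min (|t| + 1) T.1 := lt_min (hpos t) hT
    refine eqOn_of_hasDerivAt_skew hA (s := Ioo (-min (|t| + 1) T.1) (min (|t| + 1) T.1))
      isOpen_Ioo isPreconnected_Ioo (fun r hr => hy _ r ?_) (fun r hr => hy _ r ?_)
      (t₀ := 0) ?_ ((hy₀ _).trans (hy₀ _).symm) ?_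
    all_goals grind
  refine ⟨fun t => y ⟨|t| + 1, hpos t⟩ t, hy₀ _, fun t => ?_⟩
  have ht : t ∈ Ioo (-(|t| + 1)) (|t| + 1) := by grind
  refine (hy ⟨|t| + 1, hpos t⟩ t ht).congr_of_eventuallyEq ?_
  filter_upwards [Ioo_mem_nhds ht.1 ht.2] with r hr using heq ⟨|t| + 1, hpos t⟩ r hr

end SkewODE

lemma hasDerivAt_euclidean_iff {ι : Type*} [Fintype ι] {x : ℝ → EuclideanSpace ℝ ι}
    {x' : EuclideanSpace ℝ ι} {t : ℝ} :
    HasDerivAt x x' t ↔ ∀ i, HasDerivAt (fun u => x u i) (x' i) t := by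
  rw [← hasDerivAt_pi (φ := fun u i => x u i) (φ' := fun i => x' i)]
  exact ⟨fun h => (EuclideanSpace.equiv ι ℝ).toContinuousLinearMap.hasFDerivAt.comp_hasDerivAt t h,
    fun h =>
      (EuclideanSpace.equiv ι ℝ).symm.toContinuousLinearMap.hasFDerivAt.comp_hasDerivAt t h⟩

/-- The skew-adjoint operator `x ↦ ⟪e, x⟫ h - ⟪h, x⟫ e`. -/
noncomputable def skewRankTwo {H : Type*} [NormedAddCommGroup H] [InnerProductSpace ℝ H]
    (e h : H) : H →L[ℝ] H :=
  (innerSL ℝ e).smulRight h - (innerSL ℝ h).smulRight e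

lemma skewRankTwo_skew {H : Type*} [NormedAddCommGroup H] [InnerProductSpace ℝ H]
    (e h x y : H) : ⟪skewRankTwo e h x, y⟫ + ⟪x, skewRankTwo e h y⟫ = 0 := by
  simp only [skewRankTwo, sub_apply, ContinuousLinearMap.smulRight_apply,
    innerSL_apply_apply, inner_sub_left, inner_sub_right, real_inner_smul_left,
    real_inner_smul_right, real_inner_comm x]
  ring

lemma continuous_skewRankTwo {H : Type*} [NormedAddCommGroup H] [InnerProductSpace ℝ H]
    (e : H) {h : ℝ → H} (hh : Continuous h) : Continuous fun t => skewRankTwo e (h t) := by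
  unfold skewRankTwo
  refine .sub ?_ ?_
  · exact (ContinuousLinearMap.smulRightL ℝ H H (innerSL ℝ e)).continuous.comp hh
  · exact ((ContinuousLinearMap.smulRightL ℝ H H).flip e).continuous.comp
      ((innerSL ℝ).continuous.comp hh)

section Frame

variable {p n : ℕ}

/-- The coefficients `(0, f₁, …, f_p, g₁, …, g_n)` of the moving-frame system. -/
noncomputable def frameCoeff (f : Fin p → ℝ → ℝ) (g : Fin n → ℝ → ℝ) (t : ℝ) :
    EuclideanSpace ℝ (Fin (p + 1) ⊕ Fin n) :=
  WithLp.toLp 2 (Sum.elim (Fin.cons 0 fun j => f j t) fun k => g k t)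

/-- The matrix of the moving-frame system. -/
noncomputable def frameOperator (f : Fin p → ℝ → ℝ) (g : Fin n → ℝ → ℝ) (t : ℝ) :
    EuclideanSpace ℝ (Fin (p + 1) ⊕ Fin n) →L[ℝ] EuclideanSpace ℝ (Fin (p + 1) ⊕ Fin n) :=
  skewRankTwo (EuclideanSpace.single (Sum.inl 0) 1) (frameCoeff f g t)

lemma continuous_frameOperator {f : Fin p → ℝ → ℝ} {g : Fin n → ℝ → ℝ}
    (hf : ∀ j, Continuous (f j)) (hg : ∀ k, Continuous (g k)) :
    Continuous (frameOperator f g) := by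
  refine continuous_skewRankTwo _ ((PiLp.continuous_toLp 2 _).comp (continuous_pi ?_))
  rintro (i | k)
  · cases i using Fin.cases with
    | zero => exact continuous_const
    | succ j => exact hf j
  · exact hg k

lemma frameOperator_inl_zero (f : Fin p → ℝ → ℝ) (g : Fin n → ℝ → ℝ) (t : ℝ)
    (x : EuclideanSpace ℝ (Fin (p + 1) ⊕ Fin n)) :
    frameOperator f g t x (Sum.inl 0) =
      -(∑ j, f j t * x (Sum.inl j.succ)) - ∑ k, g k t * x (Sum.inr k) := by
  simp [frameOperator, skewRankTwo, frameCoeff, PiLp.inner_apply, Fin.sum_univ_succ, mul_comm]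
  ring

lemma frameOperator_inl_succ (f : Fin p → ℝ → ℝ) (g : Fin n → ℝ → ℝ) (t : ℝ)
    (x : EuclideanSpace ℝ (Fin (p + 1) ⊕ Fin n)) (j : Fin p) :
    frameOperator f g t x (Sum.inl j.succ) = f j t * x (Sum.inl 0) := by
  simp [frameOperator, skewRankTwo, frameCoeff, EuclideanSpace.inner_single_left, mul_comm]

lemma frameOperator_inr (f : Fin p → ℝ → ℝ) (g : Fin n → ℝ → ℝ) (t : ℝ)
    (x : EuclideanSpace ℝ (Fin (p + 1) ⊕ Fin n)) (k : Fin n) :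
    frameOperator f g t x (Sum.inr k) = g k t * x (Sum.inl 0) := by
  simp [frameOperator, skewRankTwo, frameCoeff, EuclideanSpace.inner_single_left, mul_comm]

/-- The `c`-th coordinates of all the vectors of a frame. -/
noncomputable def frameColumn {κ : Type*}
    (EN : (Fin (p + 1) → ℝ → EuclideanSpace ℝ κ) × (Fin n → ℝ → EuclideanSpace ℝ κ))
    (c : κ) (t : ℝ) : EuclideanSpace ℝ (Fin (p + 1) ⊕ Fin n) :=
  WithLp.toLp 2 (Sum.elim (fun i => EN.1 i t c) fun k => EN.2 k t c)

/-- The moving-frame system in terms of the coordinate columns. -/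
lemma frame_system_iff {κ : Type*} [Fintype κ] (f : Fin p → ℝ → ℝ) (g : Fin n → ℝ → ℝ)
    (EN : (Fin (p + 1) → ℝ → EuclideanSpace ℝ κ) × (Fin n → ℝ → EuclideanSpace ℝ κ)) :
    ((∀ i, Differentiable ℝ (EN.1 i)) ∧ (∀ k, Differentiable ℝ (EN.2 k)) ∧
      (∀ t, deriv (EN.1 0) t = -(∑ j, f j t • EN.1 j.succ t) - ∑ k, g k t • EN.2 k t) ∧
      (∀ j t, deriv (EN.1 j.succ) t = f j t • EN.1 0 t) ∧
      (∀ k t, deriv (EN.2 k) t = g k t • EN.1 0 t)) ↔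
    ∀ c t, HasDerivAt (frameColumn EN c) (frameOperator f g t (frameColumn EN c t)) t := by
  simp only [hasDerivAt_euclidean_iff (x := frameColumn EN _), Sum.forall, Fin.forall_fin_succ,
    frameOperator_inl_zero, frameOperator_inl_succ, frameOperator_inr]
  constructor
  · rintro ⟨⟨hE0, hE⟩, hN, h0, h1, h2⟩ c t
    refine ⟨⟨?_, fun j => ?_⟩, fun k => ?_⟩
    · have := hasDerivAt_euclidean_iff.1 (h0 t ▸ (hE0 t).hasDerivAt) c
      simpa [frameColumn] using this
    · have := hasDerivAt_euclidean_iff.1 (h1 j t ▸ (hE j t).hasDerivAt) c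
      simpa [frameColumn] using this
    · have := hasDerivAt_euclidean_iff.1 (h2 k t ▸ (hN k t).hasDerivAt) c
      simpa [frameColumn] using this
  · intro h
    have h0 : ∀ t, HasDerivAt (EN.1 0)
        (-(∑ j, f j t • EN.1 j.succ t) - ∑ k, g k t • EN.2 k t) t := fun t =>
      hasDerivAt_euclidean_iff.2 fun c => by simpa [frameColumn] using (h c t).1.1
    have h1 : ∀ j t, HasDerivAt (EN.1 (Fin.succ j)) (f j t • EN.1 0 t) t := fun j t =>
      hasDerivAt_euclidean_iff.2 fun c => by simpa [frameColumn] using (h c t).1.2 j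
    have h2 : ∀ k t, HasDerivAt (EN.2 k) (g k t • EN.1 0 t) t := fun k t =>
      hasDerivAt_euclidean_iff.2 fun c => by simpa [frameColumn] using (h c t).2 k
    exact ⟨⟨fun t => (h0 t).differentiableAt, fun j t => (h1 j t).differentiableAt⟩,
      fun k t => (h2 k t).differentiableAt, fun t => (h0 t).deriv, fun j t => (h1 j t).deriv,
      fun k t => (h2 k t).deriv⟩

/-- The initial conditions of the moving frame in terms of the coordinate columns. -/
lemma frame_initial_iff
    (EN : (Fin (p + 1) → ℝ → EuclideanSpace ℝ (Fin (p + 1 + n))) ×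
      (Fin n → ℝ → EuclideanSpace ℝ (Fin (p + 1 + n)))) :
    ((∀ i, EN.1 i 0 = EuclideanSpace.single (Fin.castAdd n i) (1 : ℝ)) ∧
      (∀ k, EN.2 k 0 = EuclideanSpace.single (Fin.natAdd (p + 1) k) (1 : ℝ))) ↔
    ∀ c, frameColumn EN c 0 = EuclideanSpace.single (finSumFinEquiv.symm c) 1 := by
  simp only [PiLp.ext_iff, frameColumn, Sum.forall, PiLp.single_apply, Sum.elim_inl,
    Sum.elim_inr, Equiv.eq_symm_apply, finSumFinEquiv_apply_left, finSumFinEquiv_apply_right,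
    forall_and, eq_comm (b := Fin.castAdd _ _), eq_comm (b := Fin.natAdd _ _)]
  exact and_congr forall_comm forall_comm

/-- If the columns of a square array are orthonormal, so are its rows. -/
lemma orthonormal_rows_of_columns {ι κ : Type*} [Fintype ι] [Fintype κ] [DecidableEq ι]
    [DecidableEq κ] (e : ι ≃ κ) {v : ι → EuclideanSpace ℝ κ} {w : κ → EuclideanSpace ℝ ι}
    (hvw : ∀ i c, w c i = v i c) (hw : Orthonormal ℝ w) : Orthonormal ℝ v := by
  rw [orthonormal_iff_ite] at hw ⊢
  let M : Matrix ι κ ℝ := Matrix.of fun i c => v i c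
  have h : M.transpose * M = 1 := by
    ext c d
    have := hw c d
    simp only [PiLp.inner_apply, hvw] at this
    simp only [Matrix.mul_apply, Matrix.transpose_apply, M, Matrix.of_apply, Matrix.one_apply,
      ← this]
    exact Finset.sum_congr rfl fun i _ => mul_comm _ _
  rw [Matrix.mul_eq_one_comm_of_equiv e.symm] at h
  intro i j
  have := congrFun₂ h i j
  simp only [Matrix.mul_apply, Matrix.transpose_apply, M, Matrix.of_apply, Matrix.one_apply] at this
  rw [← this, PiLp.inner_apply]
  exact Finset.sum_congr rfl fun i _ => mul_comm _ _

end Frame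

/-- **The moving-frame ODE system of developable submanifolds.** For smooth
functions `f₁, …, f_{m-1}, g₁, …, g_n : ℝ → ℝ` there exist unique differentiable
maps `E₁, …, E_m, N₁, …, N_n : ℝ → ℝ^(m+n)` satisfying the linear system
`E₁' = -Σ_j f_j E_{j+1} - Σ_k g_k N_k`, `E_{j+1}' = f_j E₁`, `N_k' = g_k E₁`
with `E_i(0) = b_i`, `N_k(0) = b_{m+k}`; moreover for every `t` the vectors
`E₁(t), …, E_m(t), N₁(t), …, N_n(t)` form an orthonormal family. -/
theorem developable_frame_ode
    (m n : ℕ) (hm : 2 ≤ m) (hn : 1 ≤ n)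
    (f : Fin (m - 1) → ℝ → ℝ) (g : Fin n → ℝ → ℝ)
    (hf : ∀ j, ContDiff ℝ (⊤ : ℕ∞) (f j)) (hg : ∀ k, ContDiff ℝ (⊤ : ℕ∞) (g k))
    (P : ((Fin m → ℝ → EuclideanSpace ℝ (Fin (m + n))) ×
          (Fin n → ℝ → EuclideanSpace ℝ (Fin (m + n)))) → Prop)
    (hP : ∀ EN, P EN ↔
      ((∀ i, Differentiable ℝ (EN.1 i)) ∧ (∀ k, Differentiable ℝ (EN.2 k)) ∧
       (∀ t, deriv (EN.1 ⟨0, by omega⟩) t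
          = - (∑ j : Fin (m - 1), f j t • EN.1 ⟨j.1 + 1, by have := j.2; omega⟩ t)
            - ∑ k, g k t • EN.2 k t) ∧
       (∀ (j : Fin (m - 1)) (t : ℝ),
          deriv (EN.1 ⟨j.1 + 1, by have := j.2; omega⟩) t
            = f j t • EN.1 ⟨0, by omega⟩ t) ∧
       (∀ (k : Fin n) (t : ℝ), deriv (EN.2 k) t = g k t • EN.1 ⟨0, by omega⟩ t) ∧
       (∀ i : Fin m, EN.1 i 0 = EuclideanSpace.single (Fin.castAdd n i) (1 : ℝ)) ∧
       (∀ k : Fin n, EN.2 k 0 = EuclideanSpace.single (Fin.natAdd m k) (1 : ℝ)))) :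
    (∃! EN, P EN) ∧
    ∀ EN, P EN → ∀ t : ℝ,
      Orthonormal ℝ (Sum.elim (fun i : Fin m => EN.1 i t) (fun k : Fin n => EN.2 k t)) := by
  obtain ⟨p, rfl⟩ : ∃ p, m = p + 1 := ⟨m - 1, by omega⟩
  have hA : ∀ t x y, ⟪frameOperator (p := p) f g t x, y⟫
      + ⟪x, frameOperator (p := p) f g t y⟫ = 0 := fun t => skewRankTwo_skew _ _
  have hP' : ∀ EN, P EN ↔
      (∀ c t, HasDerivAt (frameColumn EN c)
        (frameOperator (p := p) f g t (frameColumn EN c t)) t) ∧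
      ∀ c, frameColumn EN c 0 = EuclideanSpace.single (finSumFinEquiv.symm c) 1 := fun EN => by
    rw [hP, ← frame_system_iff, ← frame_initial_iff]
    simp only [and_assoc]
    rfl
  refine ⟨?_, fun EN hEN t => ?_⟩
  · choose x hx₀ hx using fun c : Fin (p + 1 + n) =>
      exists_hasDerivAt_skew (continuous_frameOperator (p := p) (fun j => (hf j).continuous)
        fun k => (hg k).continuous) hA (EuclideanSpace.single (finSumFinEquiv.symm c) 1)
    have hcol : ∀ c, frameColumn (fun i t => WithLp.toLp 2 fun c => x c t (Sum.inl i),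
        fun k t => WithLp.toLp 2 fun c => x c t (Sum.inr k)) c = x c := fun c => by
      ext t (i | k) <;> rfl
    refine ⟨(fun i t => WithLp.toLp 2 fun c => x c t (Sum.inl i),
      fun k t => WithLp.toLp 2 fun c => x c t (Sum.inr k)), (hP' _).2 ?_, fun EN hEN => ?_⟩
    · simp only [hcol]
      exact ⟨hx, hx₀⟩
    · obtain ⟨hd, h0⟩ := (hP' EN).1 hEN
      have heq : ∀ c t, frameColumn EN c t = x c t := fun c t =>
        eqOn_of_hasDerivAt_skew hA isOpen_univ isPreconnected_univ (fun t _ => hd c t)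
          (fun t _ => hx c t) (mem_univ 0) ((h0 c).trans (hx₀ c).symm) (mem_univ t)
      refine Prod.ext ?_ ?_ <;> ext i t c
      · exact congrArg (fun z => z (Sum.inl i)) (heq c t)
      · exact congrArg (fun z => z (Sum.inr i)) (heq c t)
  · obtain ⟨hd, h0⟩ := (hP' EN).1 hEN
    refine orthonormal_rows_of_columns finSumFinEquiv (w := fun c => frameColumn EN c t) ?_ ?_
    · rintro (i | k) c <;> rfl
    · rw [orthonormal_iff_ite]
      intro c d
      rw [inner_eq_of_hasDerivAt_skew hA isOpen_univ isPreconnected_univ (fun t _ => hd c t)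
        (fun t _ => hd d t) (mem_univ 0) (mem_univ t), h0, h0]
      simp [EuclideanSpace.inner_single_left]
end

section
/- Let d ≥ 2 and let N : ℝ → ℝ^d be a differentiable map with ⟨N(t), N(t)⟩ = 1 for all t ∈ ℝ. Let X, Y : ℝ → ℝ^d be differentiable maps both satisfying the linear ODE Z'(t) = −⟨N'(t), Z(t)⟩·N(t) for all t ∈ ℝ, and assume ⟨X(0), N(0)⟩ = 0 and ⟨Y(0), N(0)⟩ = 0. Then the function t ↦ ⟨X(t), Y(t)⟩ is constant on ℝ. -/
open RealInnerProductSpace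

/-- A solution of `Z' = -⟪N', Z⟫ • N` that starts orthogonal to the unit field `N` stays
orthogonal to it. -/
theorem inner_eq_zero_of_frame_ode {E : Type*} [NormedAddCommGroup E] [InnerProductSpace ℝ E]
    {N Z : ℝ → E} (hN : Differentiable ℝ N) (hNunit : ∀ t : ℝ, ⟪N t, N t⟫ = 1)
    (hZ : Differentiable ℝ Z) (hode : ∀ t : ℝ, deriv Z t = -⟪deriv N t, Z t⟫ • N t)
    (hZN0 : ⟪Z 0, N 0⟫ = 0) (t : ℝ) : ⟪Z t, N t⟫ = 0 := by
  rw [← hZN0]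
  refine is_const_of_deriv_eq_zero (f := fun t => ⟪Z t, N t⟫) (hZ.inner ℝ hN) (fun t => ?_) t 0
  rw [deriv_inner_apply ℝ (hZ t) (hN t), hode, inner_smul_left, hNunit,
    real_inner_comm (Z t) (deriv N t)]
  simp

/-- **The frame ODE preserves inner products.** Let `N : ℝ → ℝ^d` be
differentiable with `⟨N, N⟩ = 1`. If `X` and `Y` are differentiable solutions of
`Z' = -⟨N', Z⟩ • N` with `⟨X(0), N(0)⟩ = 0` and `⟨Y(0), N(0)⟩ = 0`, then
`t ↦ ⟨X(t), Y(t)⟩` is constant. -/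
theorem frame_ode_preserves_inner
    (d : ℕ) (hd : 2 ≤ d)
    (N : ℝ → EuclideanSpace ℝ (Fin d)) (hN : Differentiable ℝ N)
    (hNunit : ∀ t : ℝ, ⟪N t, N t⟫ = 1)
    (X Y : ℝ → EuclideanSpace ℝ (Fin d))
    (hX : Differentiable ℝ X) (hY : Differentiable ℝ Y)
    (hodeX : ∀ t : ℝ, deriv X t = -⟪deriv N t, X t⟫ • N t)
    (hodeY : ∀ t : ℝ, deriv Y t = -⟪deriv N t, Y t⟫ • N t)
    (hXN0 : ⟪X 0, N 0⟫ = 0) (hYN0 : ⟪Y 0, N 0⟫ = 0) :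
    ∀ s t : ℝ, ⟪X s, Y s⟫ = ⟪X t, Y t⟫ := by
  have hXN := inner_eq_zero_of_frame_ode hN hNunit hX hodeX hXN0
  have hYN := inner_eq_zero_of_frame_ode hN hNunit hY hodeY hYN0
  refine is_const_of_deriv_eq_zero (f := fun t => ⟪X t, Y t⟫) (hX.inner ℝ hY) fun t => ?_
  rw [deriv_inner_apply ℝ (hX t) (hY t), hodeX, hodeY, inner_smul_left, inner_smul_right,
    hXN, real_inner_comm (Y t) (N t), hYN]
  simp
end

section
/- Let m > l ≥ 1, n ≥ 1, and let U ⊆ ℝ^(m−l) be a compact set. Let σ̃ : ℝ^(m−l) → ℝ^(m+n) be a smooth map which is injective on U, and let X_1, …, X_l : ℝ^(m−l) → ℝ^(m+n) be smooth maps such that for every t ∈ U the m vectors ∂σ̃/∂t¹(t), …, ∂σ̃/∂t^{m−l}(t), X_1(t), …, X_l(t) are linearly independent. Then there exists ε > 0 such that the map σ : (t, u¹, …, u^l) ↦ σ̃(t) + u¹·X_1(t) + ⋯ + u^l·X_l(t), restricted to U × (−ε,ε)^l, is a smooth embedding: it is injective, its differential at every point of U × (−ε,ε)^l is injective, and it is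 a homeomorphism onto its image. -/
/-- A map that is strictly differentiable with injective derivative at a point, with
finite-dimensional domain, is injective near that point. -/
theorem HasStrictFDerivAt.exists_mem_nhds_injOn_of_injective {E F : Type*}
    [NormedAddCommGroup E] [NormedSpace ℝ E] [FiniteDimensional ℝ E]
    [NormedAddCommGroup F] [NormedSpace ℝ F] {f : E → F} {f' : E →L[ℝ] F} {x : E}
    (hf : HasStrictFDerivAt f f' x) (hf' : Function.Injective f') :
    ∃ u ∈ nhds x, Set.InjOn f u := by
  obtain ⟨K, hK, hanti⟩ := f'.injective_iff_antilipschitz.mp hf'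
  have hc : 0 < K⁻¹ / 2 := by positivity
  obtain ⟨u, hu, happ⟩ := hf.approximates_deriv_on_nhds (Or.inr hc)
  refine ⟨u, hu, fun a ha b hb hab => ?_⟩
  have h₁ : ‖f' (a - b)‖ ≤ (K⁻¹ / 2 : NNReal) * ‖a - b‖ := by
    simpa only [hab, sub_self, zero_sub, norm_neg] using happ a ha b hb
  have h₂ : ‖a - b‖ ≤ K * ‖f' (a - b)‖ := by
    simpa [dist_eq_norm] using hanti.le_mul_dist a b
  have hK' : (0 : ℝ) < K := hK
  have h₃ : (K : ℝ) * ‖f' (a - b)‖ ≤ ‖a - b‖ / 2 := by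
    calc (K : ℝ) * ‖f' (a - b)‖ ≤ K * ((K⁻¹ / 2 : NNReal) * ‖a - b‖) := by gcongr
      _ = ‖a - b‖ / 2 := by push_cast; field_simp
  rw [← sub_eq_zero, ← norm_eq_zero]
  linarith [norm_nonneg (a - b)]

/-- A `C¹` map that is injective on a compact set `K` and has injective derivative at the points
of `K` is an injective immersion on a neighborhood of `K`. -/
theorem ContDiff.exists_mem_nhdsSet_injOn_immersion {E F : Type*}
    [NormedAddCommGroup E] [NormedSpace ℝ E] [FiniteDimensional ℝ E]
    [NormedAddCommGroup F] [NormedSpace ℝ F] {f : E → F} {K : Set E}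
    (hf : ContDiff ℝ 1 f) (hK : IsCompact K) (hinj : Set.InjOn f K)
    (himm : ∀ x ∈ K, Function.Injective (fderiv ℝ f x)) :
    ∃ W ∈ nhdsSet K, Set.InjOn f W ∧ ∀ x ∈ W, Function.Injective (fderiv ℝ f x) := by
  obtain ⟨W, hW, hWinj⟩ := hinj.exists_mem_nhdsSet hK (fun x _ => hf.continuous.continuousAt)
    fun x hx => (hf.contDiffAt.hasStrictFDerivAt one_ne_zero).exists_mem_nhds_injOn_of_injective
      (himm x hx)
  have hopen : IsOpen {x | Function.Injective (fderiv ℝ f x)} :=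
    ContinuousLinearMap.isOpen_injective.preimage (hf.continuous_fderiv one_ne_zero)
  exact ⟨W ∩ {x | Function.Injective (fderiv ℝ f x)},
    Filter.inter_mem hW (hopen.mem_nhdsSet.2 himm),
    hWinj.mono Set.inter_subset_left, fun x hx => hx.2⟩

/-- A neighborhood of `K × {x}` with `K` compact contains `K × closedBall x ε` for some `ε > 0`. -/
theorem IsCompact.exists_prod_closedBall_subset {E F : Type*} [TopologicalSpace E]
    [PseudoMetricSpace F] {K : Set E} (hK : IsCompact K) {x : F} {W : Set (E × F)}
    (hW : W ∈ nhdsSet (K ×ˢ {x})) : ∃ ε > 0, K ×ˢ Metric.closedBall x ε ⊆ W := by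
  rw [hK.nhdsSet_prod_eq isCompact_singleton, nhdsSet_singleton, Filter.mem_prod_iff] at hW
  obtain ⟨A, hA, B, hB, hAB⟩ := hW
  obtain ⟨ε, hε, hεB⟩ := Metric.nhds_basis_closedBall.mem_iff.1 hB
  exact ⟨ε, hε, (Set.prod_mono (subset_of_mem_nhdsSet hA) hεB).trans hAB⟩

/-- A continuous map that is injective on a compact set restricts to an embedding of each of its
subsets. -/
theorem IsCompact.isEmbedding_restrict_of_subset {E F : Type*} [TopologicalSpace E]
    [TopologicalSpace F] [T2Space F] {f : E → F} {K S : Set E} (hK : IsCompact K)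
    (hf : ContinuousOn f K) (hinj : Set.InjOn f K) (hS : S ⊆ K) :
    Topology.IsEmbedding (S.domRestrict f) := by
  have : CompactSpace K := isCompact_iff_compactSpace.1 hK
  have hemb : Topology.IsClosedEmbedding (K.domRestrict f) :=
    hf.domRestrict.isClosedEmbedding hinj.injective
  exact hemb.isEmbedding.comp (Topology.IsEmbedding.inclusion hS)

/-- Along the base, the derivative of a ruled parametrization is injective as soon as the partial
derivatives of the base together with the ruling directions are linearly independent. -/
theorem injective_fderiv_ruled {k l : ℕ} {F : Type*} [NormedAddCommGroup F] [NormedSpace ℝ F]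
    {g : EuclideanSpace ℝ (Fin k) → F} {X : Fin l → EuclideanSpace ℝ (Fin k) → F}
    {t : EuclideanSpace ℝ (Fin k)} (hg : DifferentiableAt ℝ g t)
    (hX : ∀ j, DifferentiableAt ℝ (X j) t)
    (hind : LinearIndependent ℝ
      (Sum.elim (fun s : Fin k => fderiv ℝ g t (EuclideanSpace.single s 1)) fun j => X j t)) :
    Function.Injective (fderiv ℝ
      (fun p : EuclideanSpace ℝ (Fin k) × (Fin l → ℝ) => g p.1 + ∑ j, p.2 j • X j p.1) (t, 0)) := by
  have hfst : HasFDerivAt (Prod.fst : EuclideanSpace ℝ (Fin k) × (Fin l → ℝ) → _)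
    (ContinuousLinearMap.fst ℝ _ _) (t, (0 : Fin l → ℝ)) := hasFDerivAt_fst
  have hcoord (j : Fin l) : HasFDerivAt
      (fun p : EuclideanSpace ℝ (Fin k) × (Fin l → ℝ) => p.2 j)
      ((ContinuousLinearMap.proj j).comp (ContinuousLinearMap.snd ℝ _ _))
      (t, (0 : Fin l → ℝ)) :=
    HasFDerivAt.comp (g := fun u : Fin l → ℝ => u j) (t, (0 : Fin l → ℝ))
      (hasFDerivAt_apply j _) hasFDerivAt_snd
  have hXfst (j : Fin l) := HasFDerivAt.comp (g := X j) (t, (0 : Fin l → ℝ))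
    (hX j).hasFDerivAt hfst
  have hderiv := (HasFDerivAt.comp (g := g) (t, (0 : Fin l → ℝ)) hg.hasFDerivAt hfst).add
    (HasFDerivAt.fun_sum (u := Finset.univ) fun j _ => (hcoord j).smul (hXfst j))
  have hfd := hderiv.fderiv
  refine (injective_iff_map_eq_zero _).2 fun ⟨v, w⟩ hvw => ?_
  have hsum : fderiv ℝ g t v + ∑ j, w j • X j t = 0 := by
    have := (DFunLike.congr_fun hfd (v, w)).symm.trans hvw
    simpa using this
  have hv : fderiv ℝ g t v = ∑ s, v s • fderiv ℝ g t (EuclideanSpace.single s 1) := by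
    conv_lhs => rw [← (EuclideanSpace.basisFun (Fin k) ℝ).sum_repr v]
    simp
  have hzero := Fintype.linearIndependent_iff.1 hind (Sum.elim v w) (by
    simpa [Fintype.sum_sum_type, ← hv] using hsum)
  refine Prod.ext ?_ (funext fun j => by simpa using hzero (Sum.inr j))
  ext s
  simpa using hzero (Sum.inl s)

/-- **Embedding lemma for ruled parametrizations over a compact base.**
If `σ̃ : ℝ^(m-l) → ℝ^(m+n)` is smooth and injective on a compact set `U`, and
`X₁, …, X_l` are smooth maps such that at every `t ∈ U` the `m` vectors
`∂σ̃/∂t¹(t), …, ∂σ̃/∂t^{m-l}(t), X₁(t), …, X_l(t)` are linearly independent, then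
for some `ε > 0` the ruled map `σ(t,u) = σ̃(t) + Σ_j u^j • X_j(t)`, restricted to
`U × (-ε,ε)^l`, is a smooth embedding: injective, immersive, and a topological
embedding. -/
theorem ruled_parametrization_embedding_general_base
    (m l n : ℕ) (hl : 1 ≤ l) (hml : l < m) (hn : 1 ≤ n)
    (U : Set (EuclideanSpace ℝ (Fin (m - l)))) (hU : IsCompact U)
    (σ' : EuclideanSpace ℝ (Fin (m - l)) → EuclideanSpace ℝ (Fin (m + n)))
    (hσ' : ContDiff ℝ (⊤ : ℕ∞) σ') (hinj : Set.InjOn σ' U)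
    (X : Fin l → EuclideanSpace ℝ (Fin (m - l)) → EuclideanSpace ℝ (Fin (m + n)))
    (hX : ∀ j, ContDiff ℝ (⊤ : ℕ∞) (X j))
    (hind : ∀ t ∈ U,
      LinearIndependent ℝ
        (Sum.elim (fun s : Fin (m - l) => fderiv ℝ σ' t (EuclideanSpace.single s 1))
          (fun j : Fin l => X j t)))
    (σ : EuclideanSpace ℝ (Fin (m - l)) × (Fin l → ℝ) → EuclideanSpace ℝ (Fin (m + n)))
    (hσ : ∀ p, σ p = σ' p.1 + ∑ j, p.2 j • X j p.1) :
    ∃ ε > (0 : ℝ),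
      Set.InjOn σ (U ×ˢ {u : Fin l → ℝ | ∀ j, |u j| < ε}) ∧
      (∀ p ∈ U ×ˢ {u : Fin l → ℝ | ∀ j, |u j| < ε},
        Function.Injective (fderiv ℝ σ p)) ∧
      Topology.IsEmbedding ((U ×ˢ {u : Fin l → ℝ | ∀ j, |u j| < ε}).restrict σ) := by
  have hσ_eq : σ = fun p => σ' p.1 + ∑ j, p.2 j • X j p.1 := funext hσ
  have hcd : ContDiff ℝ 1 σ := by
    have hσ₁ : ContDiff ℝ 1 σ' := hσ'.of_le (by exact_mod_cast le_top)
    have hX₁ (j : Fin l) : ContDiff ℝ 1 (X j) := (hX j).of_le (by exact_mod_cast le_top)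
    rw [hσ_eq]
    fun_prop
  have hinj₀ : Set.InjOn σ (U ×ˢ {0}) := by
    rintro ⟨t, u⟩ ⟨ht, rfl⟩ ⟨t', u'⟩ ⟨ht', rfl⟩ h
    exact Prod.ext (hinj ht ht' (by simpa [hσ] using h)) rfl
  have himm₀ : ∀ p ∈ U ×ˢ {(0 : Fin l → ℝ)}, Function.Injective (fderiv ℝ σ p) := by
    rintro ⟨t, u⟩ ⟨ht, rfl⟩
    rw [hσ_eq]
    exact injective_fderiv_ruled (hσ'.differentiable (by simp) t)
      (fun j => (hX j).differentiable (by simp) t) (hind t ht)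
  obtain ⟨W, hW, hWinj, hWimm⟩ :=
    hcd.exists_mem_nhdsSet_injOn_immersion (hU.prod isCompact_singleton) hinj₀ himm₀
  obtain ⟨ε, hε, hεW⟩ := hU.exists_prod_closedBall_subset hW
  have hsub : U ×ˢ {u : Fin l → ℝ | ∀ j, |u j| < ε} ⊆ U ×ˢ Metric.closedBall 0 ε := by
    refine Set.prod_mono_right fun u hu => ?_
    rw [mem_closedBall_zero_iff, pi_norm_le_iff_of_nonneg hε.le]
    exact fun j => (hu j).le
  exact ⟨ε, hε, hWinj.mono (hsub.trans hεW), fun p hp => hWimm p (hεW (hsub hp)),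
    (hU.prod (isCompact_closedBall _ _)).isEmbedding_restrict_of_subset
      hcd.continuous.continuousOn (hWinj.mono hεW) hsub⟩
end
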